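/- Let α be a nonnegative integer, k a positive integer, and a_1, ..., a_k positive integers. Let U be a finite nonempty set of nonnegative integers of odd cardinality. Then the polynomial (∑_{u∈U} y^u) · (1 + y)^{(2^α − 1)·(2^{α_1} + ... + 2^{α_k})} over 𝔽₂, where a_i = 2^{α_i}·t_i with t_i odd, has at least 2^α nonzero coefficients. -/

import Mathlib

open Polynomial

/-- binary digit sum -/
def bsum (n : ℕ) : ℕ := if h : n = 0 then 0 else n % 2 + bsum (n / 2)
termination_by n
decreasing_by omega

lemma bsum_zero : bsum 0 = 0 := by rw [bsum]; simp

lemma bsum_step (n : ℕ) : bsum n = n % 2 + bsum (n / 2) := by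
  by_cases h : n = 0
  · subst h; simp [bsum_zero]
  · conv_lhs => rw [bsum]
    simp [h]

lemma bsum_even (n : ℕ) : bsum (2 * n) = bsum n := by
  rw [bsum_step, show 2 * n % 2 = 0 by omega, show 2 * n / 2 = n by omega]; simp

lemma bsum_odd (n : ℕ) : bsum (2 * n + 1) = bsum n + 1 := by
  rw [bsum_step, show (2 * n + 1) % 2 = 1 by omega, show (2 * n + 1) / 2 = n by omega]; omega

lemma bsum_succ (n : ℕ) : bsum (n + 1) ≤ bsum n + 1 := by
  induction n using Nat.strong_induction_on with
  | _ n ih =>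
    rcases Nat.even_or_odd' n with ⟨m, rfl | rfl⟩
    · rw [bsum_odd, bsum_even]
    · rw [show 2 * m + 1 + 1 = 2 * (m + 1) by ring, bsum_odd, bsum_even]
      have := ih m (by omega)
      omega

lemma bsum_add (a b : ℕ) : bsum (a + b) ≤ bsum a + bsum b := by
  induction a using Nat.strong_induction_on generalizing b with
  | _ a ih =>
    rcases Nat.eq_zero_or_pos a with rfl | ha
    · simp
    rcases Nat.even_or_odd' a with ⟨m, rfl | rfl⟩ <;>
      rcases Nat.even_or_odd' b with ⟨n, rfl | rfl⟩ <;>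
      have h := ih m (by omega) n
    · rw [← mul_add, bsum_even, bsum_even, bsum_even]; exact h
    · rw [← add_assoc, ← mul_add, bsum_odd, bsum_even, bsum_odd]; omega
    · rw [show 2 * m + 1 + 2 * n = 2 * (m + n) + 1 by ring, bsum_odd, bsum_even, bsum_odd]; omega
    · rw [show 2 * m + 1 + (2 * n + 1) = 2 * (m + n + 1) by ring, bsum_odd, bsum_even, bsum_odd]
      have := bsum_succ (m + n)
      omega

lemma bsum_shift (α q r : ℕ) (hr : r < 2 ^ α) : bsum (2 ^ α * q + r) = bsum q + bsum r := by
  induction α generalizing r with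
  | zero =>
    have : r = 0 := by simpa using hr
    subst this; simp [bsum_zero]
  | succ α ih =>
    rw [pow_succ] at hr ⊢
    rcases Nat.even_or_odd' r with ⟨m, rfl | rfl⟩
    · have := ih m (by omega)
      rw [show 2 ^ α * 2 * q + 2 * m = 2 * (2 ^ α * q + m) by ring, bsum_even, bsum_even, this]
    · have := ih m (by omega)
      rw [show 2 ^ α * 2 * q + (2 * m + 1) = 2 * (2 ^ α * q + m) + 1 by ring, bsum_odd, bsum_odd,
        this]
      omega

lemma bsum_mersenne (α : ℕ) : bsum (2 ^ α - 1) = α := by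
  induction α with
  | zero => simp [bsum_zero]
  | succ α ih =>
    have : 0 < 2 ^ α := by positivity
    rw [show 2 ^ (α + 1) - 1 = 2 * (2 ^ α - 1) + 1 by rw [pow_succ]; omega, bsum_odd, ih]

lemma le_bsum (α N : ℕ) (hN : 0 < N) (hd : 2 ^ α - 1 ∣ N) : α ≤ bsum N := by
  rcases Nat.eq_zero_or_pos α with rfl | hα
  · simp
  have h2 : 2 ≤ 2 ^ α := by
    calc 2 = 2 ^ 1 := by norm_num
      _ ≤ 2 ^ α := Nat.pow_le_pow_right (by norm_num) hα
  induction N using Nat.strong_induction_on with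
  | _ N ih =>
    have hle := Nat.le_of_dvd hN hd
    by_cases hlt : N < 2 ^ α
    · have : N = 2 ^ α - 1 := by omega
      rw [this, bsum_mersenne]
    · have hdm := Nat.div_add_mod N (2 ^ α)
      have hr := Nat.mod_lt N (show 2 ^ α > 0 by omega)
      have hq : 0 < N / 2 ^ α := Nat.div_pos (by omega) (by omega)
      generalize N / 2 ^ α = q at *
      generalize N % 2 ^ α = r at *
      have key : N = (2 ^ α - 1) * q + (q + r) := by
        obtain ⟨c, hc⟩ : ∃ c, 2 ^ α = c + 1 := ⟨2 ^ α - 1, by omega⟩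
        rw [← hdm, hc, Nat.add_sub_cancel]; ring
      have hpos : 0 < (2 ^ α - 1) * q := Nat.mul_pos (by omega) hq
      have hd' : 2 ^ α - 1 ∣ q + r := by
        rw [key] at hd
        exact (Nat.dvd_add_right (dvd_mul_right _ _)).1 hd
      have h1 := ih (q + r) (by omega) (by omega) hd'
      have h3 := bsum_add q r
      rw [← hdm, bsum_shift α q r hr]
      omega

lemma exists_split (Q : Polynomial (ZMod 2)) :
    ∃ A B : Polynomial (ZMod 2), Q = A ^ 2 + X * B ^ 2 := by
  induction Q using Polynomial.induction_on' with
  | add p q hp hq =>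
    obtain ⟨A, B, rfl⟩ := hp
    obtain ⟨C, D, rfl⟩ := hq
    refine ⟨A + C, B + D, ?_⟩
    rw [CharTwo.add_sq, CharTwo.add_sq]; ring
  | monomial n c =>
    have hc : c ^ 2 = c := by revert c; decide
    rcases Nat.even_or_odd' n with ⟨m, rfl | rfl⟩
    · refine ⟨monomial m c, 0, ?_⟩
      rw [monomial_pow, hc, mul_comm m 2]; simp
    · refine ⟨0, monomial m c, ?_⟩
      rw [monomial_pow, hc, mul_comm m 2, X_mul_monomial]; simp

lemma wt_split (A B : Polynomial (ZMod 2)) :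
    A.support.card + B.support.card ≤ (A ^ 2 + X * B ^ 2).support.card := by
  have h0 : ∀ n, (A ^ 2 + X * B ^ 2).coeff (2 * n) = A.coeff n := by
    intro n
    rw [← ZMod.expand_card, ← ZMod.expand_card, coeff_add, mul_comm 2 n,
      coeff_expand_mul (by norm_num)]
    rcases n with _ | n
    · simp
    · rw [show (n + 1) * 2 = (2 * n + 1) + 1 by ring, coeff_X_mul, coeff_expand (by norm_num),
        if_neg (by omega), add_zero]
  have h1 : ∀ n, (A ^ 2 + X * B ^ 2).coeff (2 * n + 1) = B.coeff n := by
    intro n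
    rw [← ZMod.expand_card, ← ZMod.expand_card, coeff_add, coeff_X_mul,
      coeff_expand (by norm_num), if_neg (by omega), zero_add, mul_comm 2 n,
      coeff_expand_mul (by norm_num)]
  have i0 : Function.Injective (fun n : ℕ => 2 * n) := fun a b h => by
    simp only at h; omega
  have i1 : Function.Injective (fun n : ℕ => 2 * n + 1) := fun a b h => by
    simp only at h; omega
  rw [← Finset.card_image_of_injective A.support i0, ← Finset.card_image_of_injective B.support i1,
    ← Finset.card_union_of_disjoint]
  · apply Finset.card_le_card
    intro x hx
    rw [Finset.mem_union, Finset.mem_image, Finset.mem_image] at hx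
    rcases hx with ⟨n, hn, rfl⟩ | ⟨n, hn, rfl⟩
    · rw [mem_support_iff] at hn ⊢
      simpa only [h0] using hn
    · rw [mem_support_iff] at hn ⊢
      simpa only [h1] using hn
  · rw [Finset.disjoint_left]
    intro x hx hy
    rw [Finset.mem_image] at hx hy
    obtain ⟨n, _, rfl⟩ := hx
    obtain ⟨m, _, h⟩ := hy
    omega

lemma wt_bound (N : ℕ) (Q : Polynomial (ZMod 2)) (hQ : Q.eval 1 = 1) :
    2 ^ bsum N ≤ (Q * (1 + X) ^ N).support.card := by
  induction N using Nat.strong_induction_on generalizing Q with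
  | _ N ih =>
    rcases Nat.eq_zero_or_pos N with rfl | hN
    · rw [bsum_zero, pow_zero, pow_zero, mul_one, Nat.one_le_iff_ne_zero, Ne,
        Finset.card_eq_zero, support_eq_empty]
      rintro rfl
      simp at hQ
    have hsq : ((1 : Polynomial (ZMod 2)) + X) ^ 2 = 1 + X ^ 2 := by
      rw [CharTwo.add_sq]; simp
    obtain ⟨A, B, rfl⟩ := exists_split Q
    simp only [eval_add, eval_mul, eval_pow, eval_X, one_mul] at hQ
    have hz : ∀ a b : ZMod 2, a ^ 2 + b ^ 2 = 1 → (a = 1 ∨ b = 1) ∧ a + b = 1 := by decide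
    obtain ⟨hor, hadd⟩ := hz _ _ hQ
    rcases Nat.even_or_odd' N with ⟨M, rfl | rfl⟩
    · have e : (A ^ 2 + X * B ^ 2) * (1 + X) ^ (2 * M)
          = (A * (1 + X) ^ M) ^ 2 + X * (B * (1 + X) ^ M) ^ 2 := by ring
      rw [e, bsum_even]
      refine le_trans ?_ (wt_split _ _)
      rcases hor with h | h
      · exact le_trans (ih M (by omega) A h) (Nat.le_add_right _ _)
      · exact le_trans (ih M (by omega) B h) (Nat.le_add_left _ _)
    · have e : (A ^ 2 + X * B ^ 2) * (1 + X) ^ (2 * M + 1)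
          = ((A + X * B) * (1 + X) ^ M) ^ 2 + X * ((A + B) * (1 + X) ^ M) ^ 2 := by
        rw [mul_pow, mul_pow, CharTwo.add_sq, CharTwo.add_sq]; ring
      rw [e, bsum_odd, pow_succ, mul_two]
      refine le_trans (add_le_add ?_ ?_) (wt_split _ _)
      · exact ih M (by omega) _ (by simpa using hadd)
      · exact ih M (by omega) _ (by simpa using hadd)

/-- Write `aᵢ = 2^{αᵢ} · tᵢ` with `tᵢ` odd. For any finite nonempty set `U` of
nonnegative integers of odd cardinality, the polynomial
`(∑_{u∈U} y^u) · (1 + y)^{(2^α − 1)(2^{α₁} + ⋯ + 2^{α_k})}` over `𝔽₂`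
has at least `2^α` nonzero coefficients. -/
theorem odd_combination_of_one_add_pow (α k : ℕ) (hk : 0 < k)
    (a : Fin k → ℕ) (ha : ∀ i, 0 < a i)
    (αi ti : Fin k → ℕ) (hti : ∀ i, Odd (ti i)) (hai : ∀ i, a i = 2 ^ αi i * ti i)
    (U : Finset ℕ) (hUne : U.Nonempty) (hUodd : Odd U.card) :
    2 ^ α ≤ ((∑ u ∈ U, (X : Polynomial (ZMod 2)) ^ u) *
      (1 + X) ^ ((2 ^ α - 1) * ∑ i, 2 ^ αi i)).support.card := by
  rcases Nat.eq_zero_or_pos α with rfl | hα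
  · have := wt_bound 0 (∑ u ∈ U, (X : Polynomial (ZMod 2)) ^ u) (by
      simp only [eval_finsetSum, eval_pow, eval_X, one_pow, Finset.sum_const, nsmul_eq_mul, mul_one]
      exact (ZMod.natCast_eq_one_iff_odd).2 hUodd)
    simpa [bsum_zero] using this
  have h2 : 2 ≤ 2 ^ α := by
    calc 2 = 2 ^ 1 := by norm_num
      _ ≤ 2 ^ α := Nat.pow_le_pow_right (by norm_num) hα
  have hS : 0 < ∑ i, 2 ^ αi i :=
    Finset.sum_pos (fun i _ => by positivity) ⟨⟨0, hk⟩, Finset.mem_univ _⟩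
  have hb := le_bsum α ((2 ^ α - 1) * ∑ i, 2 ^ αi i) (Nat.mul_pos (by omega) hS) (dvd_mul_right _ _)
  refine le_trans (Nat.pow_le_pow_right (by norm_num) hb) (wt_bound _ _ ?_)
  simp only [eval_finsetSum, eval_pow, eval_X, one_pow, Finset.sum_const, nsmul_eq_mul, mul_one]
  exact (ZMod.natCast_eq_one_iff_odd).2 hUodd
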